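/- Suppose the induced subdigraph D[V(P)] is a semicomplete bipartite digraph. Define I_1 = {x ∈ I : x ↦ E(P)}, I_2 = {x ∈ I : x ↦ O(P)}, W_1 = {x ∈ W : E(P) ↦ x}, and W_2 = {x ∈ W : O(P) ↦ x}. Then I_1 ∩ I_2 = ∅ and W_1 ∩ W_2 = ∅. -/

import Mathlib

variable {V : Type*}

/-- Two vertices are adjacent in the digraph with arc relation `A`. -/
def DAdj (A : V → V → Prop) (x y : V) : Prop := A x y ∨ A y x

/-- `x 0, x 1, …, x n` is a directed path of length `n` (distinct vertices, consecutive arcs). -/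
def IsDipathOn (A : V → V → Prop) (n : ℕ) (x : ℕ → V) : Prop :=
  (∀ i j, i ≤ n → j ≤ n → x i = x j → i = j) ∧ ∀ i, i < n → A (x i) (x (i + 1))

/-- There is a directed path of length `n` from `u` to `v`. -/
def HasDipath (A : V → V → Prop) (n : ℕ) (u v : V) : Prop :=
  ∃ x : ℕ → V, IsDipathOn A n x ∧ x 0 = u ∧ x n = v

/-- A digraph is `k`-quasi-transitive if the endpoints of every path of length `k` are adjacent. -/
def KQuasiTransitive (A : V → V → Prop) (k : ℕ) : Prop :=
  ∀ x : ℕ → V, IsDipathOn A k x → DAdj A (x 0) (x k)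

/-- A digraph is strong if every vertex is reachable from every other vertex. -/
def StrongD (A : V → V → Prop) : Prop := ∀ u v : V, ∃ n, HasDipath A n u v

/-- The subdigraph induced on `S` is semicomplete. -/
def SemicompleteOn (A : V → V → Prop) (S : Set V) : Prop :=
  ∀ x ∈ S, ∀ y ∈ S, x ≠ y → DAdj A x y

/-- The subdigraph induced on `S` is semicomplete bipartite. -/
def SemicompleteBipartiteOn (A : V → V → Prop) (S : Set V) : Prop :=
  ∃ X Y : Set V, X ∪ Y = S ∧ X ∩ Y = ∅ ∧
    (∀ x ∈ X, ∀ y ∈ X, ¬ DAdj A x y) ∧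
    (∀ x ∈ Y, ∀ y ∈ Y, ¬ DAdj A x y) ∧
    (∀ x ∈ X, ∀ y ∈ Y, DAdj A x y)

/-- The subdigraph induced on `S` has no arcs. -/
def EmptyOn (A : V → V → Prop) (S : Set V) : Prop :=
  ∀ x ∈ S, ∀ y ∈ S, ¬ A x y

/-- The vertex set `{P 0, …, P n}` of a path. -/
def VertsUpTo (n : ℕ) (P : ℕ → V) : Set V := {w | ∃ i ≤ n, P i = w}

/-- The odd-indexed vertices among `{P 0, …, P n}`. -/
def OddVertsUpTo (n : ℕ) (P : ℕ → V) : Set V := {w | ∃ i, i ≤ n ∧ Odd i ∧ P i = w}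

/-- The even-indexed vertices among `{P 0, …, P n}`. -/
def EvenVertsUpTo (n : ℕ) (P : ℕ → V) : Set V := {w | ∃ i, i ≤ n ∧ Even i ∧ P i = w}

/-- `I`: vertices outside `S` receiving no arc from `S`. -/
def ISet (A : V → V → Prop) (S : Set V) : Set V :=
  {x | x ∉ S ∧ ∀ w ∈ S, ¬ A w x}

/-- `W`: vertices outside `S` sending no arc to `S`. -/
def WSet (A : V → V → Prop) (S : Set V) : Set V :=
  {x | x ∉ S ∧ ∀ w ∈ S, ¬ A x w}

/-- `B`: vertices outside `S` that are in neither `I` nor `W`. -/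
def BSet (A : V → V → Prop) (S : Set V) : Set V :=
  {x | x ∉ S ∧ x ∉ ISet A S ∧ x ∉ WSet A S}

/-- Distinct offsets below the modulus give distinct vertices on an injective cycle. -/
theorem cycle_offset_injective {n : ℕ} {C : ZMod n → V} (hC : Function.Injective C) {i : ZMod n}
    {a b : ℕ} (ha : a < n) (hb : b < n) (h : C (i + a) = C (i + b)) : a = b := by
  have h' : (a : ZMod n) = b := add_left_cancel (hC h)
  rw [ZMod.natCast_eq_natCast_iff'] at h'
  rwa [Nat.mod_eq_of_lt ha, Nat.mod_eq_of_lt hb] at h'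

/-- A path `a, b` followed by a segment of a cycle has adjacent end vertices. -/
theorem KQuasiTransitive.adj_of_two_then_cycle {A : V → V → Prop} {k : ℕ} (hk : 5 ≤ k)
    (hQT : KQuasiTransitive A k) {C : ZMod (k + 3) → V} (hC : Function.Injective C)
    (hcyc : ∀ i, A (C i) (C (i + 1))) {a b : V} (i : ZMod (k + 3)) (hab : a ≠ b)
    (ha : ∀ j : ℕ, 2 ≤ j → j ≤ k → a ≠ C (i + j)) (hb : ∀ j, b ≠ C j)
    (harc : A a b) (hbC : ∀ j, A b (C j)) : DAdj A a (C (i + k)) := by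
  let x : ℕ → V := fun j => if j = 0 then a else if j = 1 then b else C (i + j)
  have hx0 : x 0 = a := rfl
  have hx1 : x 1 = b := rfl
  have hx : ∀ j, 2 ≤ j → x j = C (i + j) := fun j hj => by
    simp only [x]; rw [if_neg (by omega), if_neg (by omega)]
  have hpath : IsDipathOn A k x := by
    have hlt : ∀ p q, p < q → q ≤ k → x p ≠ x q := by
      intro p q hpq hq he
      rcases p with _ | _ | p
      · rcases q with _ | _ | q
        · omega
        · exact hab he
        · rw [hx0, hx _ (by omega)] at he
          exact ha _ (by omega) hq he
      · rw [zero_add, hx1, hx _ (by omega)] at he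
        exact hb _ he
      · rw [hx _ (by omega), hx _ (by omega)] at he
        have := cycle_offset_injective hC (by omega) (by omega) he
        omega
    refine ⟨fun p q hp hq he => ?_, fun j hj => ?_⟩
    · rcases lt_trichotomy p q with h | h | h
      · exact absurd he (hlt p q h hq)
      · exact h
      · exact absurd he.symm (hlt q p h hp)
    · rcases j with _ | _ | j
      · exact harc
      · rw [zero_add, hx1, hx _ (by omega)]
        exact hbC _
      · rw [hx _ (by omega), hx _ (by omega)]
        have := hcyc (i + ((j + 1 + 1 : ℕ) : ZMod (k + 3)))
        rwa [add_assoc i, ← Nat.cast_succ] at this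
  have := hQT x hpath
  rwa [hx0, hx k (by omega)] at this

/-- A path leaving a cycle at `C i`, passing through two outside vertices, and returning to the
cycle has adjacent end vertices. -/
theorem KQuasiTransitive.adj_of_cycle_detour {A : V → V → Prop} {k : ℕ} (hk : 5 ≤ k)
    (hQT : KQuasiTransitive A k) {C : ZMod (k + 3) → V} (hC : Function.Injective C)
    (hcyc : ∀ i, A (C i) (C (i + 1))) {a b : V} (i : ZMod (k + 3)) (hab : a ≠ b)
    (ha : ∀ j, a ≠ C j) (hb : ∀ j, b ≠ C j) (hia : A (C i) a)
    (harc : A a b) (hbC : ∀ j, A b (C j)) : DAdj A (C i) (C (i + (k + 1 : ℕ))) := by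
  let x : ℕ → V := fun j => if j = 0 then C i else if j = 1 then a else if j = 2 then b
    else C (i + (j + 1 : ℕ))
  have hx0 : x 0 = C i := rfl
  have hx1 : x 1 = a := rfl
  have hx2 : x 2 = b := rfl
  have hx : ∀ j, 3 ≤ j → x j = C (i + (j + 1 : ℕ)) := fun j hj => by
    simp only [x]; rw [if_neg (by omega), if_neg (by omega), if_neg (by omega)]
  have hpath : IsDipathOn A k x := by
    have hlt : ∀ p q, p < q → q ≤ k → x p ≠ x q := by
      intro p q hpq hq he
      rcases p with _ | _ | _ | p
      · rcases q with _ | _ | _ | q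
        · omega
        · exact ha _ he.symm
        · exact hb _ he.symm
        · rw [hx0, hx _ (by omega)] at he
          have := cycle_offset_injective hC (i := i) (a := 0) (b := q + 1 + 1 + 1 + 1)
            (by omega) (by omega) (by simpa using he)
          omega
      · rcases q with _ | _ | _ | q
        · omega
        · omega
        · exact hab he
        · rw [zero_add, hx1, hx _ (by omega)] at he
          exact ha _ he
      · rw [zero_add, hx2, hx _ (by omega)] at he
        exact hb _ he
      · rw [hx _ (by omega), hx _ (by omega)] at he
        have := cycle_offset_injective hC (by omega) (by omega) he
        omega
    refine ⟨fun p q hp hq he => ?_, fun j hj => ?_⟩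
    · rcases lt_trichotomy p q with h | h | h
      · exact absurd he (hlt p q h hq)
      · exact h
      · exact absurd he.symm (hlt q p h hp)
    · rcases j with _ | _ | _ | j
      · exact hia
      · exact harc
      · rw [zero_add, hx2, hx _ (by omega)]
        exact hbC _
      · rw [hx _ (by omega), hx _ (by omega)]
        have := hcyc (i + ((j + 1 + 1 + 1 + 1 : ℕ) : ZMod (k + 3)))
        rwa [add_assoc i, ← Nat.cast_succ] at this
  have := hQT x hpath
  rwa [hx0, hx k (by omega)] at this

/-- In a `k`-quasi-transitive digraph with a cycle of length `k + 3` in which vertices at cyclic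
distance two are nonadjacent, no vertex reachable from the cycle dominates the whole cycle. -/
theorem KQuasiTransitive.not_dominates_cycle {A : V → V → Prop} (hirr : ∀ x, ¬ A x x) {k : ℕ}
    (hk : 5 ≤ k) (hQT : KQuasiTransitive A k) {C : ZMod (k + 3) → V} (hC : Function.Injective C)
    (hcyc : ∀ i, A (C i) (C (i + 1))) (hnon : ∀ i, ¬ DAdj A (C i) (C (i + 2))) {x : V}
    (hreach : Relation.ReflTransGen A (C 0) x) (hx : ∀ i, A x (C i)) : False := by
  have hback : ∀ i : ZMod (k + 3), i + ((k + 1 : ℕ) : ZMod (k + 3)) + 2 = i := fun i => by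
    have h : ((k + 3 : ℕ) : ZMod (k + 3)) = 0 := ZMod.natCast_self _
    push_cast at h ⊢
    linear_combination h
  have hnon' : ∀ i, ¬ DAdj A (C i) (C (i + (k + 1 : ℕ))) := fun i h => by
    apply hnon (i + (k + 1 : ℕ))
    rw [hback]
    exact h.symm
  have hout : ∀ z, (∀ i, A z (C i)) → ∀ j, z ≠ C j := fun z hz j h => by
    subst h
    exact hirr _ (hz j)
  have hnoarc : ∀ z, (∀ i, A z (C i)) → ∀ i, ¬ A (C i) z := fun z hz i hiz => by
    have h := hQT.adj_of_two_then_cycle hk hC hcyc (i + 1) (hout z hz i).symm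
      (fun j _ hj he => by
        have h0 := cycle_offset_injective hC (i := i) (a := 0) (b := j + 1)
          (by omega) (by omega) (by
            rw [Nat.cast_zero, add_zero, he, Nat.cast_succ, add_assoc, add_comm 1])
        omega) (hout z hz) hiz hz
    apply hnon' i
    rwa [add_assoc, add_comm 1, ← Nat.cast_succ] at h
  have hdom : ∀ i, A (C 0) (C i) := by
    refine Relation.ReflTransGen.head_induction_on
      (motive := fun w _ => ∀ i, A w (C i)) hreach hx ?_
    intro w z hwz _ hz i
    have hne : w ≠ z := fun h => hirr z (h ▸ hwz)
    have hw : ∀ j, w ≠ C j := fun j h => hnoarc z hz j (h ▸ hwz)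
    have h := hQT.adj_of_two_then_cycle hk hC hcyc (i - k) hne (fun j _ _ => hw _)
      (hout z hz) hwz hz
    rw [sub_add_cancel] at h
    exact h.resolve_right fun hiw => hnon' i
      (hQT.adj_of_cycle_detour hk hC hcyc i hne hw (hout z hz) hiw hwz hz)
  exact hirr _ (hdom 0)

/-- Reversing all arcs preserves `k`-quasi-transitivity. -/
theorem KQuasiTransitive.swap {A : V → V → Prop} {k : ℕ} (hQT : KQuasiTransitive A k) :
    KQuasiTransitive (Function.swap A) k := by
  intro x ⟨hinj, harc⟩
  have h := hQT (fun i => x (k - i)) ⟨fun i j hi hj he => by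
    have := hinj _ _ (by omega) (by omega) he
    omega, fun i hi => by
    have := harc (k - (i + 1)) (by omega)
    rwa [show k - (i + 1) + 1 = k - i by omega] at this⟩
  simpa [DAdj, Function.swap] using h

/-- A directed path makes its last vertex reachable from its first. -/
theorem HasDipath.reflTransGen {A : V → V → Prop} {n : ℕ} {a b : V} (h : HasDipath A n a b) :
    Relation.ReflTransGen A a b := by
  obtain ⟨x, ⟨-, harc⟩, rfl, rfl⟩ := h
  have : ∀ m ≤ n, Relation.ReflTransGen A (x 0) (x m) := by
    intro m
    induction m with
    | zero => exact fun _ => .refl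
    | succ m ih => exact fun hm => (ih (by omega)).tail (harc m (by omega))
  exact this n le_rfl

/-- If the vertices of a path induce a semicomplete bipartite digraph, adjacency is decided by the
parity of the indices. -/
theorem SemicompleteBipartiteOn.adj_iff_parity {A : V → V → Prop} {n : ℕ} {P : ℕ → V}
    (hbip : SemicompleteBipartiteOn A (VertsUpTo n P)) (hP : IsDipathOn A n P)
    {i j : ℕ} (hi : i ≤ n) (hj : j ≤ n) : DAdj A (P i) (P j) ↔ ¬ (Even i ↔ Even j) := by
  obtain ⟨X, Y, hU, hdisj, hX, hY, hXY⟩ := hbip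
  have hmem : ∀ i ≤ n, P i ∈ X ∨ P i ∈ Y := fun i hi => by
    have : P i ∈ X ∪ Y := hU ▸ ⟨i, hi, rfl⟩
    exact this
  have hnot : ∀ w, w ∈ X → w ∉ Y := fun w h1 h2 => by
    have : w ∈ X ∩ Y := ⟨h1, h2⟩
    rw [hdisj] at this
    exact this
  have hpar : ∀ i ≤ n, (P i ∈ X ↔ (Even i ↔ P 0 ∈ X)) := by
    intro i
    induction i with
    | zero => simp
    | succ i ih =>
      intro hi
      have ih := ih (by omega)
      have harc := hP.2 i (by omega)
      have h1 : P (i + 1) ∈ X ↔ ¬ P i ∈ X :=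
        ⟨fun h h' => hX _ h' _ h (.inl harc), fun h => (hmem _ hi).resolve_right
          fun h' => hY _ ((hmem i (by omega)).resolve_left h) _ h' (.inl harc)⟩
      rw [h1, ih, Nat.even_add_one]
      tauto
  have hadj : DAdj A (P i) (P j) ↔ ¬ (P i ∈ X ↔ P j ∈ X) := by
    constructor
    · intro h hij
      by_cases hiX : P i ∈ X
      · exact hX _ hiX _ (hij.1 hiX) h
      · exact hY _ ((hmem i hi).resolve_left hiX) _
          ((hmem j hj).resolve_left fun h' => hiX (hij.2 h')) h
    · intro h
      by_cases hiX : P i ∈ X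
      · exact hXY _ hiX _ ((hmem j hj).resolve_left fun h' => h ⟨fun _ => h', fun _ => hiX⟩)
      · have hjX : P j ∈ X := by tauto
        exact (hXY _ hjX _ ((hmem i hi).resolve_left hiX)).symm
  rw [hadj, hpar i hi, hpar j hj]
  tauto

theorem stmt_19
    {V : Type*} [Fintype V] (A : V → V → Prop) (hirr : Irreflexive A)
    (k : ℕ) (hk5 : 5 ≤ k) (hkodd : Odd k)
    (hQT : KQuasiTransitive A k) (hstrong : StrongD A)
    (u v : V) (hdist : ∀ m, m < k + 2 → ¬ HasDipath A m u v)
    (P : ℕ → V) (hP : IsDipathOn A (k + 2) P) (hPu : P 0 = u) (hPv : P (k + 2) = v)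
    (hbip : SemicompleteBipartiteOn A (VertsUpTo (k + 2) P)) :
    ∀ I1 I2 W1 W2 : Set V,
      I1 = {x ∈ ISet A (VertsUpTo (k + 2) P) |
        ∀ w ∈ EvenVertsUpTo (k + 2) P, A x w ∧ ¬ A w x} →
      I2 = {x ∈ ISet A (VertsUpTo (k + 2) P) |
        ∀ w ∈ OddVertsUpTo (k + 2) P, A x w ∧ ¬ A w x} →
      W1 = {x ∈ WSet A (VertsUpTo (k + 2) P) |
        ∀ w ∈ EvenVertsUpTo (k + 2) P, A w x ∧ ¬ A x w} →
      W2 = {x ∈ WSet A (VertsUpTo (k + 2) P) |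
        ∀ w ∈ OddVertsUpTo (k + 2) P, A w x ∧ ¬ A x w} →
      I1 ∩ I2 = ∅ ∧ W1 ∩ W2 = ∅ := by
  intro I1 I2 W1 W2 hI1 hI2 hW1 hW2
  have hval : ∀ i : ZMod (k + 3), i.val ≤ k + 2 := fun i => by
    have := ZMod.val_lt i
    omega
  have hback : A (P (k + 2)) (P 0) := by
    have h := (hbip.adj_iff_parity hP (Nat.zero_le _) le_rfl).2 (by
      have : ¬ Even (k + 2) := by
        rw [Nat.not_even_iff_odd]
        exact hkodd.add_even even_two
      simp [this])
    refine h.resolve_left fun h01 => hdist 1 (by omega) ?_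
    refine ⟨fun i => if i = 0 then u else v, ⟨?_, ?_⟩, rfl, rfl⟩
    · have huv : u ≠ v := fun he => by
        have := hP.1 0 (k + 2) (by omega) le_rfl (by rw [hPu, hPv, he])
        omega
      intro i j hi hj he
      have hi' : i = 0 ∨ i = 1 := by omega
      have hj' : j = 0 ∨ j = 1 := by omega
      rcases hi' with rfl | rfl <;> rcases hj' with rfl | rfl
      · rfl
      · exact absurd he huv
      · exact absurd he.symm huv
      · rfl
    · intro i hi
      obtain rfl : i = 0 := by omega
      simpa [← hPu, ← hPv] using h01
  let C : ZMod (k + 3) → V := fun i => P i.val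
  have hC : Function.Injective C := fun i j h =>
    ZMod.val_injective _ (hP.1 _ _ (hval i) (hval j) h)
  have hcyc : ∀ i, A (C i) (C (i + 1)) := by
    intro i
    have hone : (1 : ZMod (k + 3)).val = 1 := ZMod.val_one_eq_one_mod _ |>.trans
      (Nat.mod_eq_of_lt (by omega))
    simp only [C, ZMod.val_add, hone]
    rcases (hval i).lt_or_eq with h | h
    · rw [Nat.mod_eq_of_lt (by omega)]
      exact hP.2 _ h
    · rw [h, Nat.mod_self]
      exact hback
  have hnon : ∀ i, ¬ DAdj A (C i) (C (i + 2)) := by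
    intro i
    have htwo : (2 : ZMod (k + 3)).val = 2 := by
      have := ZMod.val_natCast (k + 3) 2
      rwa [Nat.mod_eq_of_lt (by omega)] at this
    simp only [C]
    rw [hbip.adj_iff_parity hP (hval i) (hval _), not_not, ZMod.val_add, htwo]
    have hi := hval i
    rw [Nat.even_iff, Nat.even_iff]
    rw [Nat.odd_iff] at hkodd
    rcases lt_or_ge (i.val + 2) (k + 3) with h | h
    · rw [Nat.mod_eq_of_lt h]
      omega
    · rw [Nat.mod_eq_sub_mod h, Nat.mod_eq_of_lt (a := i.val + 2 - (k + 3)) (by omega)]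
      omega
  have hreach : ∀ a b, Relation.ReflTransGen A a b := fun a b =>
    (hstrong a b).choose_spec.reflTransGen
  subst hI1 hI2 hW1 hW2
  refine ⟨Set.eq_empty_iff_forall_notMem.2 ?_, Set.eq_empty_iff_forall_notMem.2 ?_⟩
  · rintro x ⟨⟨-, hE⟩, -, hO⟩
    refine hQT.not_dominates_cycle hirr hk5 hC hcyc hnon (hreach _ x) fun i => ?_
    rcases Nat.even_or_odd i.val with h | h
    · exact (hE _ ⟨_, hval i, h, rfl⟩).1
    · exact (hO _ ⟨_, hval i, h, rfl⟩).1
  · rintro x ⟨⟨-, hE⟩, -, hO⟩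
    refine hQT.swap.not_dominates_cycle (A := Function.swap A) (C := fun i => C (-i)) hirr hk5
      (hC.comp neg_injective) (fun i => ?_) (fun i h => ?_)
      (Relation.reflTransGen_swap.2 (hreach x _)) fun i => ?_
    · have := hcyc (-(i + 1))
      rwa [show -(i + 1) + 1 = -i by ring] at this
    · have := hnon (-(i + 2))
      rw [show -(i + 2) + 2 = -i by ring] at this
      exact this h
    · rcases Nat.even_or_odd (-i).val with h | h
      · exact (hE _ ⟨_, hval (-i), h, rfl⟩).1
      · exact (hO _ ⟨_, hval (-i), h, rfl⟩).1
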